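/- For every formula α, the sequent ⇒ □(α ∨ ¬□α) is provable in 𝔊, but it has no derivation in 𝔊 that avoids the cut rule; i.e., every proof of ⇒ □(α ∨ ¬□α) in 𝔊 uses the cut rule. -/

import Mathlib

/-- Formulas built from propositional variables and the constant `⊥`
by the connectives `∧`, `∨`, `¬`, `□`. -/
inductive FormulaB : Type where
  | var : ℕ → FormulaB
  | bot : FormulaB
  | and : FormulaB → FormulaB → FormulaB
  | or : FormulaB → FormulaB → FormulaB
  | neg : FormulaB → FormulaB
  | box : FormulaB → FormulaB
deriving DecidableEq
/-- The Font–Rius sequent calculus 𝔊.  `Gder c Δ α` means the sequent `Δ ⇒ α` has a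
derivation; when `c = false` the cut rule is not allowed (cut-free derivability),
`Gder true` is plain derivability. -/
inductive Gder : Bool → Finset FormulaB → FormulaB → Prop where
  | ax (c : Bool) (α : FormulaB) : Gder c {α} α
  | modal (c : Bool) (α : FormulaB) : Gder c ∅ (α.or α.box.neg)
  | weak {c Δ α} (β : FormulaB) : Gder c Δ α → Gder c (insert β Δ) α
  | cut {Δ : Finset FormulaB} {α β : FormulaB} :
      Gder true Δ α → Gder true (insert α Δ) β → Gder true Δ β
  | andL {c Δ γ} (α β : FormulaB) :
      Gder c (insert α (insert β Δ)) γ → Gder c (insert (α.and β) Δ) γ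
  | andR {c Δ} {α β : FormulaB} : Gder c Δ α → Gder c Δ β → Gder c Δ (α.and β)
  | orL {c Δ γ} (α β : FormulaB) :
      Gder c (insert α Δ) γ → Gder c (insert β Δ) γ → Gder c (insert (α.or β) Δ) γ
  | orR1 {c Δ} {α : FormulaB} (β : FormulaB) : Gder c Δ α → Gder c Δ (α.or β)
  | orR2 {c Δ} (α : FormulaB) {β : FormulaB} : Gder c Δ β → Gder c Δ (α.or β)
  | negRule {c} {α β : FormulaB} : Gder c {α} β → Gder c {β.neg} α.neg
  | botRule {c Δ} (α : FormulaB) : Gder c Δ FormulaB.bot → Gder c Δ α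
  | nnL {c Δ β} (α : FormulaB) : Gder c (insert α Δ) β → Gder c (insert α.neg.neg Δ) β
  | nnR {c Δ} {α : FormulaB} : Gder c Δ α → Gder c Δ α.neg.neg
  | boxL {c Δ β} (α : FormulaB) :
      Gder c (insert α (insert α.neg Δ)) β → Gder c (insert α (insert α.box.neg Δ)) β
  | boxR {c Δ} {α : FormulaB} :
      Gder c Δ (α.and α.neg) → Gder c Δ (α.and α.box.neg)

namespace Gder

theorem cut_empty {α β : FormulaB} (h₁ : Gder true ∅ α) (h₂ : Gder true {α} β) :
    Gder true ∅ β :=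
  cut h₁ (by simpa using h₂)

theorem trans_singleton {α β γ : FormulaB} (h₁ : Gder true {α} β) (h₂ : Gder true {β} γ) :
    Gder true {α} γ :=
  cut h₁ (by simpa [Finset.pair_comm] using weak α h₂)

theorem weak_empty {c : Bool} {α : FormulaB} (β : FormulaB) (h : Gder c ∅ α) :
    Gder c {β} α := by
  simpa using weak β h

theorem neg_neg_elim (c : Bool) (α : FormulaB) : Gder c {α.neg.neg} α := by
  simpa using nnL (Δ := ∅) α (by simpa using ax c α)

theorem top_intro : Gder true ∅ FormulaB.bot.neg := by
  refine cut_empty (modal true .bot) ?_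
  have h₁ : Gder true {FormulaB.bot} FormulaB.bot.neg := botRule _ (ax _ _)
  have h₂ : Gder true {FormulaB.bot.box.neg} FormulaB.bot.neg := negRule (botRule _ (ax _ _))
  simpa using orL (Δ := ∅) FormulaB.bot FormulaB.bot.box.neg (by simpa using h₁)
    (by simpa using h₂)

/-- Negations of theorems are contradictory. -/
theorem neg_derives_bot {φ : FormulaB} (h : Gder true ∅ φ) : Gder true {φ.neg} .bot :=
  trans_singleton (negRule (weak_empty FormulaB.bot.neg h)) (neg_neg_elim _ _)

/-- The necessitation rule is admissible in the calculus with cut. -/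
theorem necessitation {φ : FormulaB} (h : Gder true ∅ φ) : Gder true ∅ φ.box := by
  have h₁ : Gder true (insert φ (insert φ.box.neg ∅)) .bot :=
    boxL φ (weak φ (by simpa using neg_derives_bot h))
  have h₂ : Gder true {φ.box.neg} .bot :=
    cut (weak_empty _ h) (by simpa using h₁)
  exact cut_empty top_intro (trans_singleton (negRule h₂) (neg_neg_elim _ _))

/-- Without cut, neither `⊥` nor any boxed formula is derivable from the empty context. -/
theorem ne_bot_and_ne_box_of_cutFree {c : Bool} {Δ : Finset FormulaB} {γ : FormulaB}
    (h : Gder c Δ γ) : c = false → Δ = ∅ → γ ≠ .bot ∧ ∀ φ : FormulaB, γ ≠ φ.box := by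
  induction h <;> simp_all

end Gder

/-- For every formula `α`, `⇒ □(α ∨ ¬□α)` is provable in 𝔊 but every proof of it
uses the cut rule (it has no cut-free derivation). -/
theorem box_modal_axiom_needs_cut (α : FormulaB) :
    Gder true ∅ (α.or α.box.neg).box ∧ ¬ Gder false ∅ (α.or α.box.neg).box :=
  ⟨Gder.necessitation (Gder.modal true α),
    fun h => (Gder.ne_bot_and_ne_box_of_cutFree h rfl rfl).2 _ rfl⟩
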